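/- The intersection hierarchy and the union hierarchy of deterministic context-free languages are both infinite hierarchies: for every integer d ≥ 1, DCFL(d) is a proper subfamily of DCFL(d+1), and DCFL[d] is a proper subfamily of DCFL[d+1]. -/

import Mathlib

/-!
Formalization of one-way deterministic pushdown automata (1dpda) following
Yamakami, "Intersection and Union Hierarchies of Deterministic Context-Free
Languages and Pumping Lemmas".
-/

namespace DCFLFormal

/-- Tape symbols: the left endmarker ¢, the right endmarker $, and input symbols. -/
inductive TSym (α : Type) : Type
  | lend : TSym α
  | rend : TSym α
  | ch : α → TSym α

/-- A one-way deterministic pushdown automaton (1dpda).  `δ q (some t) a` is the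
transition reading the tape symbol `t` with top stack symbol `a`; `δ q none a`
is the ε-transition.  The value `some (p, w)` means: change state to `p` and
replace the topmost stack symbol by the string `w`. -/
structure DPDA (Q α Γ : Type) where
  δ : Q → Option (TSym α) → Γ → Option (Q × List Γ)
  q0 : Q
  Z0 : Γ
  Acc : Set Q
  Rej : Set Q

/-- A configuration: current state, remaining (unread) tape, and stack content
(topmost symbol first, the bottom marker last). -/
structure Cfg (Q α Γ : Type) where
  st : Q
  inp : List (TSym α)
  stk : List Γ

namespace DPDA

variable {Q α Γ : Type}

/-- Halting (accepting or rejecting) states. -/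
def IsHalting (M : DPDA Q α Γ) (q : Q) : Prop := q ∈ M.Acc ∨ q ∈ M.Rej

/-- One step of the machine: an ε-move if one is defined, otherwise read the
next tape symbol; the head moves right exactly when a tape symbol is read. -/
def step (M : DPDA Q α Γ) (c : Cfg Q α Γ) : Option (Cfg Q α Γ) :=
  match c.stk with
  | [] => none
  | a :: s =>
    match M.δ c.st none a with
    | some (p, w) => some ⟨p, c.inp, w ++ s⟩
    | none =>
      match c.inp with
      | [] => none
      | t :: rest =>
        match M.δ c.st (some t) a with
        | some (p, w) => some ⟨p, rest, w ++ s⟩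
        | none => none

/-- Iterated steps. -/
def stepN (M : DPDA Q α Γ) : ℕ → Cfg Q α Γ → Option (Cfg Q α Γ)
  | 0, c => some c
  | n + 1, c => (M.step c).bind (M.stepN n)

/-- The tape holding ¢ x $. -/
def tape (x : List α) : List (TSym α) :=
  TSym.lend :: x.map TSym.ch ++ [TSym.rend]

/-- The initial configuration on input `x`. -/
def init (M : DPDA Q α Γ) (x : List α) : Cfg Q α Γ := ⟨M.q0, tape x, [M.Z0]⟩

/-- `M` accepts `x`: the computation reaches an accepting state. -/
def Accepts (M : DPDA Q α Γ) (x : List α) : Prop :=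
  ∃ n c, M.stepN n (M.init x) = some c ∧ c.st ∈ M.Acc

/-- `M` rejects `x`: the computation reaches a rejecting state. -/
def Rejects (M : DPDA Q α Γ) (x : List α) : Prop :=
  ∃ n c, M.stepN n (M.init x) = some c ∧ c.st ∈ M.Rej

/-- `M` halts (in an accepting or rejecting state) on every input. -/
def HaltsOnAll (M : DPDA Q α Γ) : Prop :=
  ∀ x : List α, ∃ n c, M.stepN n (M.init x) = some c ∧ M.IsHalting c.st

/-- The language recognized by `M`. -/
def lang (M : DPDA Q α Γ) : Set (List α) := {x | M.Accepts x}

/-- Well-formedness of a 1dpda: accepting and rejecting states are disjoint,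
halting states have no outgoing transitions, for every non-halting state,
stack symbol and (non-empty) tape symbol exactly one of the symbol- and the
ε-transition is defined, and the bottom marker Z₀ is never removed. -/
def Valid (M : DPDA Q α Γ) : Prop :=
  (∀ q, q ∈ M.Acc → q ∉ M.Rej) ∧
  (∀ q, M.IsHalting q → ∀ σ a, M.δ q σ a = none) ∧
  (∀ q, ¬ M.IsHalting q → ∀ σ a, ((M.δ q (some σ) a).isSome ↔ M.δ q none a = none)) ∧
  (∀ q σ p w, M.δ q σ M.Z0 = some (p, w) → w ≠ [])

end DPDA

/-- A language is deterministic context-free if it is recognized by some 1dpda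
(with finitely many states and stack symbols) that halts on all inputs. -/
def IsDCFL {α : Type} (L : Set (List α)) : Prop :=
  ∃ (Q Γ : Type) (_ : Fintype Q) (_ : Fintype Γ) (M : DPDA Q α Γ),
    M.Valid ∧ M.HaltsOnAll ∧ L = M.lang

/-- `DCFL(d)`: intersections of `d` dcf languages. -/
def DCFLInter {α : Type} (d : ℕ) (L : Set (List α)) : Prop :=
  ∃ f : Fin d → Set (List α), (∀ i, IsDCFL (f i)) ∧ L = ⋂ i, f i

/-- `DCFL[d]`: unions of `d` dcf languages. -/
def DCFLUnion {α : Type} (d : ℕ) (L : Set (List α)) : Prop :=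
  ∃ f : Fin d → Set (List α), (∀ i, IsDCFL (f i)) ∧ L = ⋃ i, f i

/-- `rep x i` is the string `x` repeated `i` times. -/
def rep {α : Type} (x : List α) (i : ℕ) : List α := (List.replicate i x).flatten

/-- `(x, y)` is an iterative pair of the string `u ++ x ++ v ++ y ++ z` for `L`. -/
def IterPair {α : Type} (L : Set (List α)) (u x v y z : List α) : Prop :=
  1 ≤ (x ++ y).length ∧ ∀ i : ℕ, u ++ rep x i ++ v ++ rep y i ++ z ∈ L

/-- A nondegenerate iterative pair: either `{u xⁱ v yʲ z ∈ L : j ≥ 0}` is finite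
for each `i`, or `{u xⁱ v yʲ z ∈ L : i ≥ 0}` is finite for each `j`. -/
def NonDegIterPair {α : Type} (L : Set (List α)) (u x v y z : List α) : Prop :=
  IterPair L u x v y z ∧
  ((∀ i : ℕ, {s | s ∈ L ∧ ∃ j : ℕ, s = u ++ rep x i ++ v ++ rep y j ++ z}.Finite) ∨
   (∀ j : ℕ, {s | s ∈ L ∧ ∃ i : ℕ, s = u ++ rep x i ++ v ++ rep y j ++ z}.Finite))



namespace DPDA

variable {Q α Γ : Type}

/-- Reachability: zero or more steps of the machine. -/
def Reach (M : DPDA Q α Γ) : Cfg Q α Γ → Cfg Q α Γ → Prop :=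
  Relation.ReflTransGen (fun c c' => M.step c = some c')

/-- An accepting state is reachable from the configuration. -/
def AcceptsFrom (M : DPDA Q α Γ) (c : Cfg Q α Γ) : Prop :=
  ∃ c', M.Reach c c' ∧ c'.st ∈ M.Acc

lemma reach_iff_stepN (M : DPDA Q α Γ) (c c' : Cfg Q α Γ) :
    M.Reach c c' ↔ ∃ n, M.stepN n c = some c' := by
  constructor
  · intro h
    induction h using Relation.ReflTransGen.head_induction_on with
    | refl => exact ⟨0, rfl⟩
    | head h _ ih =>
      obtain ⟨n, hn⟩ := ih
      exact ⟨n + 1, by simp [stepN, h, hn]⟩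
  · rintro ⟨n, hn⟩
    induction n generalizing c with
    | zero =>
      simp only [stepN, Option.some.injEq] at hn
      exact hn ▸ Relation.ReflTransGen.refl
    | succ n ih =>
      simp only [stepN, Option.bind_eq_some_iff] at hn
      obtain ⟨c₁, h₁, h₂⟩ := hn
      exact Relation.ReflTransGen.head h₁ (ih c₁ h₂)

lemma accepts_iff (M : DPDA Q α Γ) (x : List α) :
    M.Accepts x ↔ M.AcceptsFrom (M.init x) := by
  simp only [Accepts, AcceptsFrom, reach_iff_stepN]
  exact ⟨fun ⟨n, c, h, h'⟩ => ⟨c, ⟨n, h⟩, h'⟩, fun ⟨c, ⟨n, h⟩, h'⟩ => ⟨n, c, h, h'⟩⟩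

lemma rejects_iff (M : DPDA Q α Γ) (x : List α) :
    M.Rejects x ↔ ∃ c, M.Reach (M.init x) c ∧ c.st ∈ M.Rej := by
  simp only [Rejects, reach_iff_stepN]
  exact ⟨fun ⟨n, c, h, h'⟩ => ⟨c, ⟨n, h⟩, h'⟩, fun ⟨c, ⟨n, h⟩, h'⟩ => ⟨n, c, h, h'⟩⟩

lemma Reach.total {M : DPDA Q α Γ} {c c₁ c₂ : Cfg Q α Γ} (h₁ : M.Reach c c₁)
    (h₂ : M.Reach c c₂) : M.Reach c₁ c₂ ∨ M.Reach c₂ c₁ :=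
  Relation.ReflTransGen.total_of_right_unique
    (fun _ _ _ h h' => Option.some.inj (h.symm.trans h')) h₁ h₂

lemma Reach.eq_of_step_none {M : DPDA Q α Γ} {c c' : Cfg Q α Γ} (h : M.Reach c c')
    (hc : M.step c = none) : c' = c := by
  rcases Relation.ReflTransGen.cases_head h with h | ⟨_, h, _⟩
  · exact h.symm
  · simp [hc] at h

lemma step_nil (M : DPDA Q α Γ) (q : Q) (x : List (TSym α)) : M.step ⟨q, x, []⟩ = none := rfl

lemma Valid.step_eq_none {M : DPDA Q α Γ} (hM : M.Valid) {c : Cfg Q α Γ}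
    (hc : M.IsHalting c.st) : M.step c = none := by
  obtain ⟨q, x, w⟩ := c
  have := hM.2.1 q hc
  cases w with
  | nil => rfl
  | cons a s => cases x <;> simp [step, this]

/-- Adding unread input and covered stack does not affect a step. -/
lemma step_append {M : DPDA Q α Γ} {q q' : Q} {x x' : List (TSym α)} {w w' : List Γ}
    (h : M.step ⟨q, x, w⟩ = some ⟨q', x', w'⟩) (y : List (TSym α)) (r : List Γ) :
    M.step ⟨q, x ++ y, w ++ r⟩ = some ⟨q', x' ++ y, w' ++ r⟩ := by
  cases w with
  | nil => simp [step] at h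
  | cons a s =>
    cases h0 : M.δ q none a with
    | some pw =>
      simp only [step, h0, Option.some.injEq, Cfg.mk.injEq] at h
      obtain ⟨rfl, rfl, rfl⟩ := h
      simp [step, h0]
    | none =>
      cases x with
      | nil => simp [step, h0] at h
      | cons t x =>
        cases h1 : M.δ q (some t) a with
        | none => simp [step, h0, h1] at h
        | some pw =>
          simp only [step, h0, h1, Option.some.injEq, Cfg.mk.injEq] at h
          obtain ⟨rfl, rfl, rfl⟩ := h
          simp [step, h0, h1]

/-- A step from a stack `w ++ r` with `w` non-empty does not depend on `r`. -/
lemma step_stack_strip {M : DPDA Q α Γ} {q : Q} {x : List (TSym α)} {w r : List Γ}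
    {c : Cfg Q α Γ} (hw : w ≠ []) (h : M.step ⟨q, x, w ++ r⟩ = some c) :
    ∃ w', c.stk = w' ++ r ∧ M.step ⟨q, x, w⟩ = some ⟨c.st, c.inp, w'⟩ := by
  cases w with
  | nil => exact absurd rfl hw
  | cons a s =>
    cases h0 : M.δ q none a with
    | some pw =>
      simp only [step, List.cons_append, h0, Option.some.injEq] at h
      subst h
      exact ⟨pw.2 ++ s, by simp, by simp [step, h0]⟩
    | none =>
      cases x with
      | nil => simp [step, h0] at h
      | cons t x =>
        cases h1 : M.δ q (some t) a with
        | none => simp [step, h0, h1] at h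
        | some pw =>
          simp only [step, List.cons_append, h0, h1, Option.some.injEq] at h
          subst h
          exact ⟨pw.2 ++ s, by simp, by simp [step, h0, h1]⟩

lemma step_inp {M : DPDA Q α Γ} {c c' : Cfg Q α Γ} (h : M.step c = some c') :
    c.inp = c'.inp ∨ ∃ t, c.inp = t :: c'.inp := by
  obtain ⟨q, x, w⟩ := c
  cases w with
  | nil => simp [step] at h
  | cons a s =>
    cases h0 : M.δ q none a with
    | some pw =>
      simp only [step, h0, Option.some.injEq] at h
      subst h
      exact Or.inl rfl
    | none =>
      cases x with
      | nil => simp [step, h0] at h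
      | cons t x =>
        cases h1 : M.δ q (some t) a with
        | none => simp [step, h0, h1] at h
        | some pw =>
          simp only [step, h0, h1, Option.some.injEq] at h
          subst h
          exact Or.inr ⟨t, rfl⟩

/-- A step that does not read from the suffix `z` of the input does not depend on `z`. -/
lemma step_inp_strip {M : DPDA Q α Γ} {q q' : Q} {x x' z : List (TSym α)} {w w' : List Γ}
    (h : M.step ⟨q, x ++ z, w⟩ = some ⟨q', x' ++ z, w'⟩) :
    M.step ⟨q, x, w⟩ = some ⟨q', x', w'⟩ := by
  cases w with
  | nil => simp [step] at h
  | cons a s =>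
    cases h0 : M.δ q none a with
    | some pw =>
      simp only [step, h0, Option.some.injEq, Cfg.mk.injEq, List.append_cancel_right_eq] at h
      obtain ⟨rfl, rfl, rfl⟩ := h
      simp [step, h0]
    | none =>
      cases x with
      | nil =>
        cases z with
        | nil => simp [step, h0] at h
        | cons t z =>
          cases h1 : M.δ q (some t) a with
          | none => simp [step, h0, h1] at h
          | some pw =>
            simp only [step, List.nil_append, h0, h1, Option.some.injEq, Cfg.mk.injEq] at h
            have := congrArg List.length h.2.1
            simp only [List.length_append, List.length_cons] at this
            omega
      | cons t x =>
        cases h1 : M.δ q (some t) a with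
        | none => simp [step, h0, h1] at h
        | some pw =>
          simp only [step, List.cons_append, h0, h1, Option.some.injEq, Cfg.mk.injEq,
            List.append_cancel_right_eq] at h
          obtain ⟨rfl, rfl, rfl⟩ := h
          simp [step, h0, h1]

lemma Reach.append {M : DPDA Q α Γ} {c c' : Cfg Q α Γ} (h : M.Reach c c')
    (y : List (TSym α)) (r : List Γ) :
    M.Reach ⟨c.st, c.inp ++ y, c.stk ++ r⟩ ⟨c'.st, c'.inp ++ y, c'.stk ++ r⟩ := by
  induction h with
  | refl => exact Relation.ReflTransGen.refl
  | tail _ h ih => exact ih.tail (step_append h y r)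

lemma Reach.inp_suffix {M : DPDA Q α Γ} {c c' : Cfg Q α Γ} (h : M.Reach c c') :
    c'.inp <:+ c.inp := by
  induction h with
  | refl => exact List.suffix_refl _
  | tail _ h ih =>
    refine List.IsSuffix.trans ?_ ih
    rcases step_inp h with h | ⟨t, h⟩
    · rw [h]
    · rw [h]
      exact List.suffix_cons _ _

/-- Input that is never read can be removed from a computation. -/
lemma Reach.inp_strip {M : DPDA Q α Γ} {q p : Q} {x y z : List (TSym α)} {w w' : List Γ}
    (h : M.Reach ⟨q, x ++ z, w⟩ ⟨p, y ++ z, w'⟩) : M.Reach ⟨q, x, w⟩ ⟨p, y, w'⟩ := by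
  generalize hc : (⟨p, y ++ z, w'⟩ : Cfg Q α Γ) = c at h
  induction h generalizing p y w' with
  | refl =>
    simp only [Cfg.mk.injEq, List.append_cancel_right_eq] at hc
    obtain ⟨rfl, rfl, rfl⟩ := hc
    exact Relation.ReflTransGen.refl
  | @tail b c _ h ih =>
    subst hc
    obtain ⟨q₁, x₁, w₁⟩ := b
    rcases step_inp h with hx | ⟨t, hx⟩
    · dsimp only at hx
      subst hx
      exact (ih rfl).tail (step_inp_strip h)
    · dsimp only at hx
      rw [← List.cons_append] at hx
      subst hx
      exact (ih rfl).tail (step_inp_strip h)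

/-- A computation on stack `w ++ r` either keeps `r` untouched or first removes all of `w`. -/
lemma Reach.stack_decomp {M : DPDA Q α Γ} {q : Q} {x : List (TSym α)} {w r : List Γ}
    {c : Cfg Q α Γ} (h : M.Reach ⟨q, x, w ++ r⟩ c) :
    (∃ w', c.stk = w' ++ r ∧ M.Reach ⟨q, x, w⟩ ⟨c.st, c.inp, w'⟩) ∨
      ∃ p y, M.Reach ⟨q, x, w⟩ ⟨p, y, []⟩ ∧ M.Reach ⟨p, y, r⟩ c := by
  induction h with
  | refl => exact Or.inl ⟨w, rfl, Relation.ReflTransGen.refl⟩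
  | @tail b c _ h ih =>
    rcases ih with ⟨w', hw', hr⟩ | ⟨p, y, h₁, h₂⟩
    · obtain ⟨q₁, x₁, w₁⟩ := b
      dsimp only at hw' hr
      subst hw'
      by_cases hw : w' = []
      · subst hw
        exact Or.inr ⟨q₁, x₁, hr, Relation.ReflTransGen.single h⟩
      · obtain ⟨w'', h₁, h₂⟩ := step_stack_strip hw h
        exact Or.inl ⟨w'', h₁, hr.tail h₂⟩
    · exact Or.inr ⟨p, y, h₁, h₂.tail h⟩

/-- A computation on input `x ++ z` either keeps `z` unread or first reads all of `x`. -/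
lemma Reach.inp_decomp {M : DPDA Q α Γ} {q : Q} {x z : List (TSym α)} {w : List Γ}
    {c : Cfg Q α Γ} (h : M.Reach ⟨q, x ++ z, w⟩ c) :
    (∃ x', c.inp = x' ++ z) ∨ ∃ p w', M.Reach ⟨q, x, w⟩ ⟨p, [], w'⟩ := by
  induction h with
  | refl => exact Or.inl ⟨x, rfl⟩
  | @tail b c hb h ih =>
    rcases ih with ⟨x', hx'⟩ | h'
    · obtain ⟨q₁, x₁, w₁⟩ := b
      dsimp only at hx'
      subst hx'
      cases x' with
      | nil => exact Or.inr ⟨q₁, w₁, inp_strip hb⟩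
      | cons s x' =>
        rcases step_inp h with h | ⟨t, h⟩
        · exact Or.inl ⟨s :: x', h.symm⟩
        · simp only [List.cons_append, List.cons.injEq] at h
          exact Or.inl ⟨x', h.2.symm⟩
    · exact Or.inr h'

lemma Valid.acceptsFrom_iff {M : DPDA Q α Γ} (hM : M.Valid) {c c' : Cfg Q α Γ}
    (h : M.Reach c c') : M.AcceptsFrom c ↔ M.AcceptsFrom c' := by
  constructor
  · rintro ⟨d, hd, hacc⟩
    rcases h.total hd with h | h
    · exact ⟨d, h, hacc⟩
    · rw [h.eq_of_step_none (hM.step_eq_none (Or.inl hacc))]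
      exact ⟨d, Relation.ReflTransGen.refl, hacc⟩
  · rintro ⟨d, hd, hacc⟩
    exact ⟨d, h.trans hd, hacc⟩

lemma Valid.not_accepts_of_rejects {M : DPDA Q α Γ} (hM : M.Valid) {x : List α}
    (h : M.Rejects x) : ¬ M.Accepts x := by
  rw [rejects_iff] at h
  rw [accepts_iff]
  rintro ⟨c, hc, hacc⟩
  obtain ⟨c', hc', hrej⟩ := h
  rcases hc.total hc' with h | h
  · rw [h.eq_of_step_none (hM.step_eq_none (Or.inl hacc))] at hrej
    exact hM.1 _ hacc hrej
  · rw [h.eq_of_step_none (hM.step_eq_none (Or.inr hrej))] at hacc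
    exact hM.1 _ hacc hrej

/-- The machine with accepting and rejecting states exchanged. -/
def swap (M : DPDA Q α Γ) : DPDA Q α Γ := { M with Acc := M.Rej, Rej := M.Acc }

lemma stepN_swap (M : DPDA Q α Γ) (n : ℕ) (c : Cfg Q α Γ) :
    M.swap.stepN n c = M.stepN n c := by
  induction n generalizing c with
  | zero => rfl
  | succ n ih => exact congrArg (Option.bind (M.step c)) (funext ih)

lemma Valid.swap {M : DPDA Q α Γ} (hM : M.Valid) : M.swap.Valid :=
  ⟨fun q h h' => hM.1 q h' h, fun q h => hM.2.1 q (Or.symm h),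
    fun q h => hM.2.2.1 q (fun h' => h (Or.symm h')), hM.2.2.2⟩

end DPDA

open DPDA

lemma isDCFL_of_decides {Q α Γ : Type} [Fintype Q] [Fintype Γ] {M : DPDA Q α Γ}
    (hM : M.Valid) {L : Set (List α)} (hacc : ∀ x ∈ L, M.Accepts x)
    (hrej : ∀ x ∉ L, M.Rejects x) : IsDCFL L := by
  refine ⟨Q, Γ, ‹_›, ‹_›, M, hM, fun x => ?_, Set.ext fun x => ⟨hacc x, fun h => ?_⟩⟩
  · by_cases hx : x ∈ L
    · obtain ⟨n, c, h, h'⟩ := hacc x hx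
      exact ⟨n, c, h, Or.inl h'⟩
    · obtain ⟨n, c, h, h'⟩ := hrej x hx
      exact ⟨n, c, h, Or.inr h'⟩
  · by_contra hx
    exact hM.not_accepts_of_rejects (hrej x hx) h

lemma IsDCFL.compl {α : Type} {L : Set (List α)} (h : IsDCFL L) : IsDCFL Lᶜ := by
  obtain ⟨Q, Γ, _, _, M, hM, hhalt, rfl⟩ := h
  refine isDCFL_of_decides hM.swap (fun x hx => ?_) (fun x hx => ?_)
  · obtain ⟨n, c, h, h' | h'⟩ := hhalt x
    · exact absurd ⟨n, c, h, h'⟩ hx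
    · exact ⟨n, c, (stepN_swap M n _).trans h, h'⟩
  · obtain ⟨n, c, h, h'⟩ := not_not.mp hx
    exact ⟨n, c, (stepN_swap M n _).trans h, h'⟩

lemma DCFLUnion.compl {α : Type} {d : ℕ} {L : Set (List α)} (h : DCFLUnion d L) :
    DCFLInter d Lᶜ := by
  obtain ⟨f, hf, rfl⟩ := h
  exact ⟨fun i => (f i)ᶜ, fun i => (hf i).compl, Set.compl_iUnion f⟩

lemma DCFLInter.compl {α : Type} {d : ℕ} {L : Set (List α)} (h : DCFLInter d L) :
    DCFLUnion d Lᶜ := by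
  obtain ⟨f, hf, rfl⟩ := h
  exact ⟨fun i => (f i)ᶜ, fun i => (hf i).compl, Set.compl_iInter f⟩

lemma DCFLUnion.succ {α : Type} {d : ℕ} (hd : 1 ≤ d) {L : Set (List α)} (h : DCFLUnion d L) :
    DCFLUnion (d + 1) L := by
  obtain ⟨f, hf, rfl⟩ := h
  have hg : Function.Surjective (fun i : Fin (d + 1) => (⟨min i (d - 1), by omega⟩ : Fin d)) :=
    fun i => ⟨i.castSucc, Fin.ext (by simp; omega)⟩
  exact ⟨fun i => f ⟨min i (d - 1), by omega⟩, fun i => hf _, (hg.iUnion_comp f).symm⟩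

lemma DCFLInter.succ {α : Type} {d : ℕ} (hd : 1 ≤ d) {L : Set (List α)} (h : DCFLInter d L) :
    DCFLInter (d + 1) L :=
  compl_compl L ▸ (h.compl.succ hd).compl

lemma rep_succ {α : Type} (v : List α) (k : ℕ) : rep v (k + 1) = v ++ rep v k := by
  simp [rep, List.replicate_succ]

lemma rep_add {α : Type} (v : List α) (j k : ℕ) : rep v (j + k) = rep v j ++ rep v k := by
  simp only [rep, List.replicate_add, List.flatten_append]

namespace DPDA

variable {Q α Γ : Type}

/-- The stack `w` is never emptied from state `q` on inputs consisting of the symbol `a`. -/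
def Immortal (M : DPDA Q α Γ) (a : TSym α) (q : Q) (w : List Γ) : Prop :=
  ∀ N p y, ¬ M.Reach ⟨q, List.replicate N a, w⟩ ⟨p, y, []⟩

/-- Consecutive computations on blocks of equal symbols compose. -/
lemma Reach.trans_replicate {M : DPDA Q α Γ} {a : TSym α} {x : List (TSym α)} {s t : ℕ}
    {q q' q'' : Q} {w₀ w w' r : List Γ} {y : List (TSym α)}
    (h : M.Reach ⟨q, x ++ List.replicate s a, w₀⟩ ⟨q', [], w ++ r⟩)
    (h' : M.Reach ⟨q', List.replicate t a, w⟩ ⟨q'', y, w'⟩) :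
    M.Reach ⟨q, x ++ List.replicate (s + t) a, w₀⟩ ⟨q'', y, w' ++ r⟩ := by
  have h₁ := h.append (List.replicate t a) []
  have h₂ := h'.append [] r
  simp only [List.append_nil, List.nil_append, List.append_assoc] at h₁ h₂
  rw [List.replicate_add]
  exact h₁.trans h₂

lemma Reach.exists_replicate {M : DPDA Q α Γ} {a : TSym α} {q p : Q} {N : ℕ}
    {w w' : List Γ} {y : List (TSym α)}
    (h : M.Reach ⟨q, List.replicate N a, w⟩ ⟨p, y, w'⟩) :
    ∃ t, M.Reach ⟨q, List.replicate t a, w⟩ ⟨p, [], w'⟩ := by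
  obtain ⟨x, hx⟩ := h.inp_suffix
  dsimp only at hx
  obtain ⟨-, hx', -⟩ := List.append_eq_replicate_iff.mp hx
  rw [← hx, hx'] at h
  exact ⟨x.length, inp_strip (x := List.replicate x.length a) (y := []) h⟩

lemma Immortal.exists_top {M : DPDA Q α Γ} {a : TSym α} {q : Q} {w : List Γ}
    (h : M.Immortal a q w) : ∃ t q' c v, M.Immortal a q' [c] ∧
      M.Reach ⟨q, List.replicate t a, w⟩ ⟨q', [], c :: v⟩ := by
  induction w generalizing q with
  | nil => exact absurd Relation.ReflTransGen.refl (h 0 q [])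
  | cons c v ih =>
    by_cases hc : M.Immortal a q [c]
    · exact ⟨0, q, c, v, hc, Relation.ReflTransGen.refl⟩
    · simp only [Immortal, not_forall, not_not] at hc
      obtain ⟨N, p, y, hr⟩ := hc
      obtain ⟨t, ht⟩ := hr.exists_replicate
      have ht' : M.Reach ⟨q, [] ++ List.replicate t a, c :: v⟩ ⟨p, [], v ++ []⟩ := by
        simpa using ht.append [] v
      have hv : M.Immortal a p v := by
        intro N' p' y' h'
        exact h (t + N') p' y' (by simpa using ht'.trans_replicate h')
      obtain ⟨t', q', c', v', hi, hr'⟩ := ih hv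
      exact ⟨t + t', q', c', v', hi, by simpa using ht'.trans_replicate hr'⟩

/-- If the computation on `e a a a ⋯` reads every symbol, the stack contents after reading
`a`-blocks of lengths in an arithmetic progression grow by repetition of a fixed word. -/
lemma exists_periodic_stack [Finite Q] [Finite Γ] {M : DPDA Q α Γ} {e a : TSym α} {q₀ : Q}
    {w₀ : List Γ}
    (hG : ∀ N, ∃ q w, M.Reach ⟨q₀, [e] ++ List.replicate N a, w₀⟩ ⟨q, [], w⟩) :
    ∃ s p, 1 ≤ p ∧ ∀ r, ∃ q x v u, ∀ k, M.Reach
      ⟨q₀, [e] ++ List.replicate (s + k * p + r) a, w₀⟩ ⟨q, [], x ++ (rep v k ++ u)⟩ := by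
  have hne : ∀ N p y, ¬ M.Reach ⟨q₀, [e] ++ List.replicate N a, w₀⟩ ⟨p, y, []⟩ := by
    intro N p y h
    have h' := h.append [a] []
    simp only [List.append_assoc, List.append_nil, ← List.replicate_succ'] at h'
    obtain ⟨q, w, hq⟩ := hG (N + 1)
    rcases h'.total hq with h | h
    · have := h.eq_of_step_none (step_nil ..)
      simp at this
    · have := h.inp_suffix
      simp at this
  have hexh : ∀ {s q c r}, M.Reach ⟨q₀, [e] ++ List.replicate s a, w₀⟩ ⟨q, [], c :: r⟩ →
      M.Immortal a q [c] → ∀ t, ∃ q' w', M.Reach ⟨q, List.replicate t a, [c]⟩ ⟨q', [], w'⟩ := by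
    intro s q c r hs hi t
    cases t with
    | zero => exact ⟨q, [c], Relation.ReflTransGen.refl⟩
    | succ t =>
      obtain ⟨q', w', h'⟩ := hG (s + (t + 1))
      have h₁ := hs.append (List.replicate (t + 1) a) []
      simp only [List.append_nil, List.nil_append, List.append_assoc,
        ← List.replicate_add] at h₁
      have h₂ : M.Reach ⟨q, List.replicate (t + 1) a, [c] ++ r⟩ ⟨q', [], w'⟩ := by
        rcases h₁.total h' with h | h
        · exact h
        · have ht := h.inp_suffix
          simp at ht
      rcases h₂.stack_decomp with ⟨w'', -, h⟩ | ⟨p, y, h, -⟩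
      · exact ⟨_, _, h⟩
      · exact absurd h (hi _ _ _)
  let P : Set (Q × Γ) := {b | M.Immortal a b.1 [b.2] ∧
    ∃ s r, M.Reach ⟨q₀, [e] ++ List.replicate s a, w₀⟩ ⟨b.1, [], b.2 :: r⟩}
  let R : P → P → Prop := fun b' b => ∃ t v, 1 ≤ t ∧
    M.Reach ⟨b.1.1, List.replicate t a, [b.1.2]⟩ ⟨b'.1.1, [], b'.1.2 :: v⟩
  have hP : P.Nonempty := by
    obtain ⟨q₁, w₁, h₁⟩ := hG 0
    have h₁' : M.Reach ⟨q₀, [e] ++ List.replicate 0 a, w₀⟩ ⟨q₁, [], w₁ ++ []⟩ := by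
      simpa using h₁
    have hi : M.Immortal a q₁ w₁ := fun N p y h =>
      hne (0 + N) p y (by simpa using h₁'.trans_replicate h)
    obtain ⟨t, q, c, v, hi', hr⟩ := hi.exists_top
    exact ⟨(q, c), hi', 0 + t, v, by simpa using h₁'.trans_replicate hr⟩
  have hR : ∀ b, ∃ b', R b' b := by
    rintro ⟨⟨q, c⟩, hi, s, r, hs⟩
    obtain ⟨q₁, w₁, h₁⟩ := hexh hs hi 1
    have h₁' : M.Reach ⟨q, [] ++ List.replicate 1 a, [c]⟩ ⟨q₁, [], w₁ ++ []⟩ := by simpa using h₁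
    have hi₁ : M.Immortal a q₁ w₁ := fun N p y h =>
      hi (1 + N) p y (by simpa using h₁'.trans_replicate h)
    obtain ⟨t, q', c', v, hi', hr⟩ := hi₁.exists_top
    have hr' : M.Reach ⟨q, List.replicate (1 + t) a, [c]⟩ ⟨q', [], c' :: v⟩ := by
      simpa using h₁'.trans_replicate hr
    exact ⟨⟨(q', c'), hi', s + (1 + t), v ++ r, Reach.trans_replicate (w := [c]) hs hr'⟩,
      1 + t, v, by omega, hr'⟩
  obtain ⟨⟨⟨q, c⟩, hi, s, u, hs⟩, p, v, hp, hv⟩ : ∃ b, R b b := by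
    by_contra! hirr
    have : IsTrans P R := ⟨by
      rintro ⟨⟨q₃, c₃⟩, h₃⟩ ⟨⟨q₂, c₂⟩, h₂⟩ ⟨⟨q₁, c₁⟩, h₁⟩ ⟨t, v, ht, h⟩ ⟨t', v', ht', h'⟩
      refine ⟨t' + t, v ++ v', by omega, ?_⟩
      have := Reach.trans_replicate (x := []) (w := [c₂]) (r := v') h' h
      simpa using this⟩
    have : Std.Irrefl R := ⟨hirr⟩
    have hwf : WellFounded R := Finite.wellFounded_of_trans_of_irrefl R
    obtain ⟨b, hb⟩ := hP
    obtain ⟨m, -, hm⟩ := hwf.has_min Set.univ ⟨⟨b, hb⟩, trivial⟩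
    obtain ⟨m', hm'⟩ := hR m
    exact hm m' trivial hm'
  dsimp only at hi hs hv
  refine ⟨s, p, hp, fun r => ?_⟩
  obtain ⟨q', x, hx⟩ := hexh hs hi r
  refine ⟨q', x, v, u, fun k => ?_⟩
  have hk : M.Reach ⟨q₀, [e] ++ List.replicate (s + k * p) a, w₀⟩
      ⟨q, [], [c] ++ (rep v k ++ u)⟩ := by
    induction k with
    | zero => simpa [rep] using hs
    | succ k ih =>
      have := ih.trans_replicate hv
      rw [add_mul, one_mul, ← add_assoc, rep_succ]
      simpa using this
  exact hk.trans_replicate hx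

/-- Replacing the covered stack `r` by `r'` preserves acceptance of `bᵐe` when every state
accepting `r` with no input left also accepts `r'`, unless `r` is uncovered while reading `bᵐ`. -/
lemma AcceptsFrom.replace_stack {M : DPDA Q α Γ} {b e : TSym α} {q : Q} {m : ℕ}
    {w r r' : List Γ} (hr : ∀ p, M.AcceptsFrom ⟨p, [], r⟩ → M.AcceptsFrom ⟨p, [], r'⟩)
    (h : M.AcceptsFrom ⟨q, List.replicate m b ++ [e], w ++ r⟩) :
    M.AcceptsFrom ⟨q, List.replicate m b ++ [e], w ++ r'⟩ ∨
      ∃ p l, M.Reach ⟨q, List.replicate m b, w⟩ ⟨p, List.replicate l b, []⟩ := by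
  obtain ⟨c, hc, hacc⟩ := h
  rcases hc.stack_decomp with ⟨w', hw', h⟩ | ⟨p, y, h, h'⟩
  · have := h.append [] r'
    simp only [List.append_nil] at this
    exact Or.inl ⟨_, this, hacc⟩
  · rcases List.suffix_concat_iff.mp h.inp_suffix with hy | ⟨l, hy, hl⟩
    · dsimp only at hy
      subst hy
      obtain ⟨c', hc', hacc'⟩ := hr p ⟨c, h', hacc⟩
      have := h.append [] r'
      simp only [List.append_nil, List.nil_append] at this
      exact Or.inl ⟨c', this.trans hc', hacc'⟩
    · dsimp only at hy
      subst hy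
      obtain ⟨z, hz⟩ := hl
      obtain ⟨-, -, hl⟩ := List.append_eq_replicate_iff.mp hz
      rw [hl] at h
      exact Or.inr ⟨p, _, h.inp_strip⟩

end DPDA

/-- The word `aⁿbᵐ` over `Bool`, with `a = false` and `b = true`. -/
def abWord (n m : ℕ) : List Bool := List.replicate n false ++ List.replicate m true

lemma abWord_inj {n m n' m' : ℕ} : abWord n m = abWord n' m' ↔ n = n' ∧ m = m' := by
  constructor
  · intro h
    have h₁ := congrArg (List.count false) h
    have h₂ := congrArg (List.count true) h
    simp [abWord, List.count_replicate] at h₁ h₂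
    exact ⟨h₁, h₂⟩
  · rintro ⟨rfl, rfl⟩
    rfl

lemma tape_abWord (n m : ℕ) : tape (abWord n m) =
    ([.lend] ++ List.replicate n (.ch false)) ++ (List.replicate m (.ch true) ++ [.rend]) := by
  simp [tape, abWord]

/-- A dcf language all of whose words are of the form `aⁿbᵐ` with `m` a bounded multiple of `n`
cannot contain two such words for infinitely many `n`. -/
lemma not_frequently_two_multiples {Q Γ : Type} [Finite Q] [Finite Γ] {M : DPDA Q Bool Γ}
    (hM : M.Valid) {D i i' : ℕ} (hii : i < i')
    (hL : ∀ x, M.Accepts x → ∃ n c, 1 ≤ c ∧ c ≤ D ∧ x = abWord n (c * n))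
    (hf : ∃ᶠ n in Filter.atTop, M.Accepts (abWord n (i * n)) ∧ M.Accepts (abWord n (i' * n))) :
    False := by
  have hL' : ∀ n m, M.Accepts (abWord n m) → n ≤ m ∧ m ≤ D * n := by
    intro n m h
    obtain ⟨n', c, h₁, h₂, h₃⟩ := hL _ h
    obtain ⟨rfl, rfl⟩ := abWord_inj.mp h₃
    exact ⟨Nat.le_mul_of_pos_left _ h₁, Nat.mul_le_mul_right _ h₂⟩
  have hG : ∀ N, ∃ q w, M.Reach
      ⟨M.q0, [.lend] ++ List.replicate N (.ch false), [M.Z0]⟩ ⟨q, [], w⟩ := by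
    intro N
    obtain ⟨n, hn, h, -⟩ := Filter.frequently_atTop.mp hf N
    rw [accepts_iff, init, tape_abWord, ← Nat.add_sub_cancel' hn, List.replicate_add,
      ← List.append_assoc [TSym.lend], List.append_assoc] at h
    obtain ⟨c, hc, hcacc⟩ := h
    rcases hc.inp_decomp with ⟨x, hx⟩ | h
    · obtain ⟨p, y, w⟩ := c
      dsimp only at hx
      subst hx
      have h' := hc.inp_strip.append (List.replicate (D * N + 1) (.ch true) ++ [.rend]) []
      simp only [List.append_nil] at h'
      have := (hL' N (D * N + 1) (by
        rw [accepts_iff, init, tape_abWord]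
        exact ⟨_, h', hcacc⟩)).2
      omega
    · exact h
  obtain ⟨s, p, hp, hper⟩ := exists_periodic_stack hG
  obtain ⟨r, hr⟩ : ∃ r, ∃ᶠ k in Filter.atTop,
      M.Accepts (abWord (s + k * p + r) (i * (s + k * p + r))) ∧
      M.Accepts (abWord (s + k * p + r) (i' * (s + k * p + r))) := by
    by_contra hcon
    rw [not_exists] at hcon
    simp only [Filter.not_frequently] at hcon
    have hev := (Filter.eventually_all_finite (Set.finite_Iio p)).mpr fun r _ => hcon r
    obtain ⟨K, hK⟩ := Filter.eventually_atTop.mp hev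
    obtain ⟨n, hn, h⟩ := Filter.frequently_atTop.mp hf (s + K * p)
    have hdiv : K ≤ (n - s) / p := (Nat.le_div_iff_mul_le hp).mpr (by omega)
    have hmod := Nat.div_add_mod' (n - s) p
    refine hK _ hdiv ((n - s) % p) (Nat.mod_lt _ hp) ?_
    rwa [show s + (n - s) / p * p + (n - s) % p = n by omega]
  obtain ⟨q, x, v, u, hk⟩ := hper r
  have hacc : ∀ k m, M.Accepts (abWord (s + k * p + r) m) ↔
      M.AcceptsFrom ⟨q, List.replicate m (.ch true) ++ [.rend], x ++ (rep v k ++ u)⟩ := by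
    intro k m
    have := (hk k).append (List.replicate m (.ch true) ++ [.rend]) []
    simp only [List.append_nil, List.nil_append] at this
    rw [accepts_iff, init, tape_abWord, hM.acceptsFrom_iff this]
  obtain ⟨V, hV⟩ := Finite.exists_infinite_fiber
    (fun j => {t | M.AcceptsFrom ⟨t, [], rep v j ++ u⟩})
  obtain ⟨K, hK⟩ := (Set.infinite_coe_iff.mp hV).nonempty
  have hpop : ∀ j, M.Accepts (abWord (s + (j + K) * p + r) (i * (s + (j + K) * p + r))) →
      ∃ t l, M.Reach ⟨q, List.replicate (i * (s + (j + K) * p + r)) (.ch true), x ++ rep v j⟩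
        ⟨t, List.replicate l (.ch true), []⟩ := by
    intro j h
    obtain ⟨K', hK', hlt⟩ := (Set.infinite_coe_iff.mp hV).exists_gt
      (i * (s + (j + K) * p + r))
    have heq : ∀ t, M.AcceptsFrom ⟨t, [], rep v K ++ u⟩ → M.AcceptsFrom ⟨t, [], rep v K' ++ u⟩ :=
      fun t ht => (Set.ext_iff.mp (hK.trans hK'.symm) t).mp ht
    rw [hacc, rep_add, List.append_assoc, ← List.append_assoc x] at h
    refine (h.replace_stack heq).resolve_left fun h' => ?_
    rw [List.append_assoc, ← List.append_assoc (rep v j), ← rep_add, ← hacc] at h'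
    have h₁ := (hL' _ _ h').1
    have h₂ : j + K' ≤ (j + K') * p := Nat.le_mul_of_pos_right _ hp
    omega
  obtain ⟨t, ht⟩ : ∃ t, ∃ᶠ j in Filter.atTop,
      M.Accepts (abWord (s + (j + K) * p + r) (i' * (s + (j + K) * p + r))) ∧
      ∃ l, M.Reach ⟨q, List.replicate (i * (s + (j + K) * p + r)) (.ch true), x ++ rep v j⟩
        ⟨t, List.replicate l (.ch true), []⟩ := by
    by_contra hcon
    rw [not_exists] at hcon
    simp only [Filter.not_frequently] at hcon
    obtain ⟨J, hJ⟩ := Filter.eventually_atTop.mp (Filter.eventually_all.mpr hcon)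
    obtain ⟨k, hkJ, h, h'⟩ := Filter.frequently_atTop.mp hr (J + K)
    obtain ⟨j, rfl⟩ := Nat.exists_eq_add_of_le' (le_of_add_le_right hkJ)
    obtain ⟨t, hl⟩ := hpop j h
    exact hJ j (by omega) t ⟨h', hl⟩
  have hshift : ∀ j l e,
      M.Reach ⟨q, List.replicate (i * (s + (j + K) * p + r)) (.ch true), x ++ rep v j⟩
        ⟨t, List.replicate l (.ch true), []⟩ →
      (M.Accepts (abWord (s + (j + K) * p + r) (i * (s + (j + K) * p + r) + e)) ↔
        M.AcceptsFrom ⟨t, List.replicate (l + e) (.ch true) ++ [.rend], rep v K ++ u⟩) := by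
    intro j l e h
    have h' := h.append (List.replicate e (.ch true) ++ [.rend]) (rep v K ++ u)
    simp only [List.nil_append, ← List.append_assoc, ← List.replicate_add] at h'
    rw [hacc, rep_add]
    simpa only [List.append_assoc] using hM.acceptsFrom_iff h'
  obtain ⟨j₁, -, l₁, hl₁⟩ := ht.exists
  obtain ⟨j₂, hj₂, h₂, l₂, hl₂⟩ :=
    Filter.frequently_atTop.mp ht (D * (s + (j₁ + K) * p + r) + l₁ + 1)
  have hle : j₂ + K ≤ (j₂ + K) * p := Nat.le_mul_of_pos_right _ hp
  generalize hn₁ : s + (j₁ + K) * p + r = n₁ at *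
  generalize hn₂ : s + (j₂ + K) * p + r = n₂ at *
  obtain ⟨e, rfl⟩ := Nat.exists_eq_add_of_lt hii
  have he : n₂ ≤ (e + 1) * n₂ := Nat.le_mul_of_pos_left _ (by omega)
  rw [show (i + e + 1) * n₂ = i * n₂ + (e + 1) * n₂ by ring, ← hn₂, hshift j₂ l₂ _ (hn₂ ▸ hl₂),
    hn₂, show l₂ + (e + 1) * n₂ = l₁ + (l₂ + (e + 1) * n₂ - l₁) by omega,
    ← hshift j₁ l₁ _ (hn₁ ▸ hl₁), hn₁] at h₂
  have := (hL' _ _ h₂).2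
  omega

/-- States of the machine recognizing `{aⁿbᶜⁿ : n ≥ 0}`. -/
inductive CounterState : Type
  | start | push | pop | acc | rej

instance : Fintype CounterState :=
  ⟨⟨([.start, .push, .pop, .acc, .rej] : List CounterState), by simp⟩, fun q => by cases q <;> simp⟩

/-- The machine recognizing `{aⁿbᶜⁿ : n ≥ 0}`: the stack symbol `false` is the bottom marker,
each `a` pushes `c` copies of `true`, and each `b` removes one of them. -/
def multipleDPDA (c : ℕ) : DPDA CounterState Bool Bool where
  δ
    | .start, some .lend, g => some (.push, [g])
    | .start, some _, g => some (.rej, [g])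
    | .push, some (.ch false), g => some (.push, List.replicate c true ++ [g])
    | .push, some (.ch true), true => some (.pop, [])
    | .push, some .rend, false => some (.acc, [false])
    | .push, some _, g => some (.rej, [g])
    | .pop, some (.ch true), true => some (.pop, [])
    | .pop, some .rend, false => some (.acc, [false])
    | .pop, some _, g => some (.rej, [g])
    | _, _, _ => none
  q0 := .start
  Z0 := false
  Acc := {.acc}
  Rej := {.rej}

lemma multipleDPDA_valid (c : ℕ) : (multipleDPDA c).Valid := by
  refine ⟨?_, ?_, ?_, ?_⟩
  · rintro q (rfl : q = _)
    simp [multipleDPDA]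
  · rintro q (rfl | rfl) σ a <;> rfl
  · intro q hq σ a
    rcases q with _ | _ | _ | _ | _ <;> rcases σ with _ | _ | (_ | _) <;> rcases a with _ | _ <;>
      simp_all [multipleDPDA, IsHalting]
  · intro q σ p w h
    rcases q with _ | _ | _ | _ | _ <;> rcases σ with _ | _ | _ | (_ | _) <;>
      simp_all [multipleDPDA] <;> simp [← h.2]

lemma multipleDPDA_pop (c : ℕ) (x : List Bool) (m : ℕ) :
    ∃ c', (multipleDPDA c).Reach
      ⟨.pop, x.map .ch ++ [.rend], List.replicate m true ++ [false]⟩ c' ∧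
      (x = List.replicate m true → c'.st = .acc) ∧ (x ≠ List.replicate m true → c'.st = .rej) := by
  induction x generalizing m with
  | nil =>
    cases m with
    | zero => exact ⟨_, .single rfl, by simp⟩
    | succ m => exact ⟨_, .single rfl, by simp [List.replicate_succ]⟩
  | cons b x ih =>
    cases b with
    | false =>
      cases m with
      | zero => exact ⟨_, .single rfl, by simp⟩
      | succ m => exact ⟨_, .single rfl, by simp [List.replicate_succ]⟩
    | true =>
      cases m with
      | zero => exact ⟨_, .single rfl, by simp⟩
      | succ m =>
        obtain ⟨c', h, h'⟩ := ih m
        exact ⟨c', .head rfl h, by simpa [List.replicate_succ] using h'⟩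

lemma multipleDPDA_push (c : ℕ) (x : List Bool) (m : ℕ) :
    ∃ c', (multipleDPDA c).Reach
      ⟨.push, x.map .ch ++ [.rend], List.replicate m true ++ [false]⟩ c' ∧
      ((∃ n, x = abWord n (c * n + m)) → c'.st = .acc) ∧
      ((¬ ∃ n, x = abWord n (c * n + m)) → c'.st = .rej) := by
  induction x generalizing m with
  | nil =>
    cases m with
    | zero => exact ⟨_, .single rfl, fun _ => rfl, fun h => absurd ⟨0, rfl⟩ h⟩
    | succ m =>
      refine ⟨_, .single rfl, fun ⟨n, h⟩ => ?_, fun _ => rfl⟩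
      simp [abWord] at h
  | cons b x ih =>
    cases b with
    | false =>
      obtain ⟨c', h, h'⟩ := ih (c + m)
      have hiff : (∃ n, false :: x = abWord n (c * n + m)) ↔
          ∃ n, x = abWord n (c * n + (c + m)) := by
        constructor
        · rintro ⟨n, hn⟩
          cases n with
          | zero =>
            cases m <;> simp [abWord, List.replicate_succ] at hn
          | succ n =>
            refine ⟨n, ?_⟩
            rw [abWord, List.replicate_succ, List.cons_append, List.cons.injEq] at hn
            rw [hn.2, abWord, mul_add, mul_one, add_assoc]
        · rintro ⟨n, rfl⟩
          refine ⟨n + 1, ?_⟩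
          rw [abWord, abWord, List.replicate_succ, List.cons_append, mul_add, mul_one, add_assoc]
      rw [hiff]
      refine ⟨c', .head ?_ h, h'⟩
      cases m <;> simp [step, multipleDPDA, List.replicate_succ, List.replicate_add]
    | true =>
      have hiff : (∃ n, true :: x = abWord n (c * n + m)) ↔ true :: x = List.replicate m true := by
        constructor
        · rintro ⟨n, hn⟩
          cases n with
          | zero => simpa [abWord] using hn
          | succ n => simp [abWord, List.replicate_succ] at hn
        · intro h
          exact ⟨0, by simpa [abWord] using h⟩
      rw [hiff]
      cases m with
      | zero => exact ⟨_, .single rfl, by simp⟩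
      | succ m =>
        obtain ⟨c', h, h'⟩ := multipleDPDA_pop c x m
        exact ⟨c', .head rfl h, by simpa [List.replicate_succ] using h'⟩

lemma isDCFL_multiple (c : ℕ) : IsDCFL {x | ∃ n, x = abWord n (c * n)} := by
  have key : ∀ x, ∃ c', (multipleDPDA c).Reach ((multipleDPDA c).init x) c' ∧
      ((∃ n, x = abWord n (c * n)) → c'.st = .acc) ∧
      ((¬ ∃ n, x = abWord n (c * n)) → c'.st = .rej) := fun x =>
    let ⟨c', h, h'⟩ := multipleDPDA_push c x 0
    ⟨c', .head rfl h, h'⟩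
  refine isDCFL_of_decides (multipleDPDA_valid c) (fun x hx => ?_) (fun x hx => ?_)
  · obtain ⟨c', h, h', -⟩ := key x
    exact (accepts_iff _ _).mpr ⟨c', h, h' hx⟩
  · obtain ⟨c', h, -, h'⟩ := key x
    exact (rejects_iff _ _).mpr ⟨c', h, h' hx⟩

/-- The words `aⁿbᶜⁿ` with `1 ≤ c ≤ d + 1`. -/
def multiplesLang (d : ℕ) : Set (List Bool) :=
  ⋃ i : Fin (d + 1), {x | ∃ n, x = abWord n ((i + 1) * n)}

lemma not_dcflUnion_multiplesLang (d : ℕ) : ¬ DCFLUnion d (multiplesLang d) := by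
  rintro ⟨f, hf, hL⟩
  have hcover : ∀ n, ∃ t : Fin (d + 1) × Fin (d + 1) × Fin d, t.1 < t.2.1 ∧
      abWord n ((t.1 + 1) * n) ∈ f t.2.2 ∧ abWord n ((t.2.1 + 1) * n) ∈ f t.2.2 := by
    intro n
    have : ∀ i : Fin (d + 1), ∃ j, abWord n ((i + 1) * n) ∈ f j := fun i =>
      Set.mem_iUnion.mp (hL ▸ Set.mem_iUnion.mpr ⟨i, n, rfl⟩)
    choose g hg using this
    obtain ⟨i, i', hne, heq⟩ := Fintype.exists_ne_map_eq_of_card_lt g (by simp)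
    rcases lt_or_gt_of_ne hne with h | h
    · exact ⟨(i, i', g i), h, hg i, heq ▸ hg i'⟩
    · exact ⟨(i', i, g i), h, heq ▸ hg i', hg i⟩
  choose T hT using hcover
  obtain ⟨⟨i, i', j⟩, hinf⟩ := Finite.exists_infinite_fiber T
  obtain ⟨Q, Γ, _, _, M, hM, -, hj⟩ := hf j
  have hmem : ∀ x, M.Accepts x ↔ x ∈ f j := fun x => by rw [hj]; rfl
  obtain ⟨n₀, hn₀⟩ := (Set.infinite_coe_iff.mp hinf).nonempty
  have hlt : i < i' := by
    have := (hT n₀).1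
    rwa [show T n₀ = (i, i', j) from hn₀] at this
  refine not_frequently_two_multiples (D := d + 1) hM (i := i + 1) (i' := i' + 1)
    (by simpa using hlt) (fun x hx => ?_)
    ((Nat.frequently_atTop_iff_infinite.mpr (Set.infinite_coe_iff.mp hinf)).mono fun n hn => ?_)
  · have hx' : x ∈ multiplesLang d := hL ▸ Set.mem_iUnion.mpr ⟨j, (hmem x).mp hx⟩
    obtain ⟨k, n, rfl⟩ := Set.mem_iUnion.mp hx'
    exact ⟨n, k + 1, by omega, by omega, rfl⟩
  · have := (hT n).2
    rw [show T n = (i, i', j) from hn] at this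
    exact ⟨(hmem _).mpr this.1, (hmem _).mpr this.2⟩

/-- The intersection hierarchy and the union hierarchy of dcf languages are
both infinite: `DCFL(d) ⊊ DCFL(d+1)` and `DCFL[d] ⊊ DCFL[d+1]` for every `d ≥ 1`. -/
theorem dcfl_hierarchies_infinite (d : ℕ) (hd : 1 ≤ d) :
    ((∀ (α : Type) (L : Set (List α)), DCFLInter d L → DCFLInter (d + 1) L) ∧
      ∃ (α : Type) (L : Set (List α)), DCFLInter (d + 1) L ∧ ¬ DCFLInter d L) ∧
    ((∀ (α : Type) (L : Set (List α)), DCFLUnion d L → DCFLUnion (d + 1) L) ∧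
      ∃ (α : Type) (L : Set (List α)), DCFLUnion (d + 1) L ∧ ¬ DCFLUnion d L) := by
  have hL : DCFLUnion (d + 1) (multiplesLang d) :=
    ⟨_, fun i => isDCFL_multiple _, rfl⟩
  exact ⟨⟨fun α L h => h.succ hd, Bool, (multiplesLang d)ᶜ, hL.compl, fun h =>
      not_dcflUnion_multiplesLang d (compl_compl (multiplesLang d) ▸ h.compl)⟩,
    fun α L h => h.succ hd, Bool, multiplesLang d, hL, not_dcflUnion_multiplesLang d⟩

end DCFLFormal
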